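/- Let E be a real normed vector space, let u : ℝ → E be three times continuously differentiable, let t ∈ ℝ, τ > 0, and let M ≥ 0 be such that ‖u'''(s)‖ ≤ M for all s ∈ [t − τ, t + τ]. Then ‖( (u(t + τ) + u(t))/2 − u(t + τ/2) ) − ( (u(t) + u(t − τ))/2 − u(t − τ/2) )‖ ≤ (5/24)·τ³·M. -/

import Mathlib

/-- Second-order Taylor expansion at `0` of a vector-valued function, with the sharp bound on the
remainder given by a bound on the third derivative. -/
theorem norm_sub_taylor_two_le
    {E : Type*} [NormedAddCommGroup E] [NormedSpace ℝ E] {f f₁ f₂ f₃ : ℝ → E}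
    (hf : ∀ x, HasDerivAt f (f₁ x) x) (hf₁ : ∀ x, HasDerivAt f₁ (f₂ x) x)
    (hf₂ : ∀ x, HasDerivAt f₂ (f₃ x) x) {h M : ℝ}
    (hM : ∀ x ∈ Set.Icc 0 h, ‖f₃ x‖ ≤ M) :
    ∀ x ∈ Set.Icc 0 h, ‖f x - f 0 - x • f₁ 0 - (x ^ 2 / 2) • f₂ 0‖ ≤ M * x ^ 3 / 6 := by
  have fence {g g' : ℝ → E} {B B' : ℝ → ℝ} (hg : ∀ x, HasDerivAt g (g' x) x)
      (hB : ∀ x, HasDerivAt B (B' x) x) (h0 : ‖g 0‖ ≤ B 0)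
      (hle : ∀ x ∈ Set.Icc 0 h, ‖g' x‖ ≤ B' x) : ∀ x ∈ Set.Icc 0 h, ‖g x‖ ≤ B x :=
    fun _ hx ↦ image_norm_le_of_norm_deriv_right_le_deriv_boundary
      (fun x _ ↦ (hg x).continuousAt.continuousWithinAt) (fun x _ ↦ (hg x).hasDerivWithinAt)
      h0 hB (fun x hx ↦ hle x (Set.Ico_subset_Icc_self hx)) hx
  have h2 : ∀ x ∈ Set.Icc 0 h, ‖f₂ x - f₂ 0‖ ≤ M * x :=
    fence (fun x ↦ (hf₂ x).sub_const _)
      (fun x ↦ by simpa using (hasDerivAt_id x).const_mul M) (by simp) hM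
  have h1 : ∀ x ∈ Set.Icc 0 h, ‖f₁ x - f₁ 0 - x • f₂ 0‖ ≤ M * x ^ 2 / 2 := by
    refine fence (fun x ↦ ?_) (fun x ↦ ?_) (by simp) h2
    · simpa using ((hf₁ x).sub_const (f₁ 0)).fun_sub ((hasDerivAt_id x).smul_const (f₂ 0))
    · exact (((hasDerivAt_pow 2 x).const_mul M).div_const 2).congr_deriv (by norm_num; ring)
  refine fence (fun x ↦ ?_) (fun x ↦ ?_) (by simp) h1
  · refine ((((hf x).sub_const (f 0)).fun_sub ((hasDerivAt_id x).smul_const (f₁ 0))).fun_sub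
      (((hasDerivAt_pow 2 x).div_const 2).smul_const (f₂ 0))).congr_deriv ?_
    simp
  · exact (((hasDerivAt_pow 3 x).const_mul M).div_const 6).congr_deriv (by norm_num; ring)

theorem ContDiff.hasDerivAt_iteratedDeriv
    {E : Type*} [NormedAddCommGroup E] [NormedSpace ℝ E] {u : ℝ → E} {n : WithTop ℕ∞}
    (hu : ContDiff ℝ n u) {k : ℕ} (hk : k < n) (x : ℝ) :
    HasDerivAt (iteratedDeriv k u) (iteratedDeriv (k + 1) u x) x := by
  rw [iteratedDeriv_succ]
  exact (hu.differentiable_iteratedDeriv k hk x).hasDerivAt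

/-- Consistency estimate (appendEq5): the defect between the two-point average and
the midpoint value changes only at third order in τ between consecutive intervals. -/
theorem average_midpoint_defect_difference
    {E : Type*} [NormedAddCommGroup E] [NormedSpace ℝ E]
    (u : ℝ → E) (hu : ContDiff ℝ 3 u)
    (t τ : ℝ) (hτ : 0 < τ) (M : ℝ) (hM : 0 ≤ M)
    (hbound : ∀ s ∈ Set.Icc (t - τ) (t + τ), ‖iteratedDeriv 3 u s‖ ≤ M) :
    ‖((2 : ℝ)⁻¹ • (u (t + τ) + u t) - u (t + τ / 2)) -
        ((2 : ℝ)⁻¹ • (u t + u (t - τ)) - u (t - τ / 2))‖ ≤ (5 / 24) * τ ^ 3 * M := by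
  have d0 (x : ℝ) : HasDerivAt u (iteratedDeriv 1 u x) x := by
    simpa using hu.hasDerivAt_iteratedDeriv (k := 0) (by norm_num) x
  have d1 := hu.hasDerivAt_iteratedDeriv (k := 1) (by norm_num)
  have d2 := hu.hasDerivAt_iteratedDeriv (k := 2) (by norm_num)
  have right :=
    norm_sub_taylor_two_le (h := τ) (fun x ↦ (d0 (t + x)).comp_const_add t x)
      (fun x ↦ (d1 (t + x)).comp_const_add t x) (fun x ↦ (d2 (t + x)).comp_const_add t x)
      (fun s hs ↦ hbound (t + s) ⟨by linarith [hs.1], by linarith [hs.2]⟩)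
  have left :=
    norm_sub_taylor_two_le (h := τ) (fun x ↦ (d0 (t - x)).comp_const_sub t x)
      (fun x ↦ ((d1 (t - x)).comp_const_sub t x).fun_neg)
      (fun x ↦ ((d2 (t - x)).comp_const_sub t x).fun_neg.fun_neg)
      (fun s hs ↦ by
        simpa using hbound (t - s) ⟨by linarith [hs.2], by linarith [hs.1]⟩)
  have full : τ ∈ Set.Icc 0 τ := ⟨hτ.le, le_rfl⟩
  have half : τ / 2 ∈ Set.Icc 0 τ := ⟨by linarith, by linarith⟩
  have r1 := right τ full
  have r2 := right (τ / 2) half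
  have l1 := left τ full
  have l2 := left (τ / 2) half
  simp only [add_zero, sub_zero, neg_neg] at r1 r2 l1 l2
  set a := u (t + τ) - u t - _ - _
  set b := u (t + τ / 2) - u t - _ - _
  set c := u (t - τ) - u t - _ - _
  set d := u (t - τ / 2) - u t - _ - _
  have key : ((2 : ℝ)⁻¹ • (u (t + τ) + u t) - u (t + τ / 2)) -
      ((2 : ℝ)⁻¹ • (u t + u (t - τ)) - u (t - τ / 2)) =
      ((2 : ℝ)⁻¹ • a - (2 : ℝ)⁻¹ • c) - (b - d) := by
    simp only [a, b, c, d]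
    module
  rw [key]
  calc _ ≤ ‖(2 : ℝ)⁻¹ • a‖ + ‖(2 : ℝ)⁻¹ • c‖ + (‖b‖ + ‖d‖) :=
        (norm_sub_le _ _).trans (add_le_add (norm_sub_le _ _) (norm_sub_le _ _))
    _ = 2⁻¹ * ‖a‖ + 2⁻¹ * ‖c‖ + (‖b‖ + ‖d‖) := by simp [norm_smul]
    _ ≤ _ := by linarith
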